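/- arXiv:2502.12794 — 2 statements merged into one kernel-verified Lean document; each statement's English description precedes it below -/
import Mathlib

section
/- Let μ₁, μ₂ ∈ ℝ, s > 0, and α ∈ ℝ. Then ∫_ℝ (φ_{μ₁,s}(x))^α · (φ_{μ₂,s}(x))^{1−α} dx = exp(α(α−1)(μ₁−μ₂)²/(2s²)), where φ_{μ,s} denotes the probability density function of the one-dimensional Gaussian distribution N(μ, s²). Consequently, for α > 1, the Rényi divergence of order α between N(μ₁, s²) and N(μ₂, s²), namely (1/(α−1)) · log of this integral, equals α(μ₁−μ₂)²/(2s²). -/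
open Real

/-- One-dimensional Gaussian pdf with mean `μ` and standard deviation `s`. -/
noncomputable def gaussPdf (μ s x : ℝ) : ℝ :=
  (2 * π * s ^ 2) ^ (-(1 : ℝ) / 2) * Real.exp (-(x - μ) ^ 2 / (2 * s ^ 2))

open MeasureTheory

theorem integral_gaussPdf (μ : ℝ) {s : ℝ} (hs : 0 < s) : ∫ x : ℝ, gaussPdf μ s x = 1 := by
  have hpos : 0 < 2 * π * s ^ 2 := by positivity
  have hexp : ∀ x : ℝ, -(x - μ) ^ 2 / (2 * s ^ 2) = -(1 / (2 * s ^ 2)) * (x - μ) ^ 2 := by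
    intro x
    ring
  simp only [gaussPdf, hexp]
  rw [integral_const_mul, integral_sub_right_eq_self
    (fun x : ℝ => Real.exp (-(1 / (2 * s ^ 2)) * x ^ 2)) μ, integral_gaussian,
    show π / (1 / (2 * s ^ 2)) = 2 * π * s ^ 2 by field_simp,
    Real.sqrt_eq_rpow, ← Real.rpow_add hpos]
  norm_num

/-- A geometric mixture of two Gaussian densities of equal scale is a multiple of the Gaussian
density centred at the corresponding arithmetic mixture of the means. -/
theorem gaussPdf_rpow_mul_rpow (μ₁ μ₂ α x : ℝ) {s : ℝ} (hs : 0 < s) :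
    gaussPdf μ₁ s x ^ α * gaussPdf μ₂ s x ^ (1 - α) =
      Real.exp (α * (α - 1) * (μ₁ - μ₂) ^ 2 / (2 * s ^ 2)) *
        gaussPdf (α * μ₁ + (1 - α) * μ₂) s x := by
  unfold gaussPdf
  have hc : 0 < (2 * π * s ^ 2) ^ (-(1 : ℝ) / 2) := by positivity
  generalize (2 * π * s ^ 2) ^ (-(1 : ℝ) / 2) = c at hc ⊢
  have hcc : c ^ α * c ^ (1 - α) = c := by
    rw [← Real.rpow_add hc, add_sub_cancel, Real.rpow_one]
  rw [Real.mul_rpow hc.le (Real.exp_pos _).le, Real.mul_rpow hc.le (Real.exp_pos _).le,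
    ← Real.exp_mul, ← Real.exp_mul, mul_mul_mul_comm, hcc, ← Real.exp_add, mul_left_comm,
    ← Real.exp_add]
  congr 2
  field_simp
  ring

/-- The Rényi integral of two Gaussians with common scale `s` equals
`exp (α (α−1) (μ₁−μ₂)² / (2 s²))`; hence for `α > 1` the order-`α` Rényi divergence
equals `α (μ₁−μ₂)² / (2 s²)`. -/
theorem gauss_renyi_integral (μ₁ μ₂ s α : ℝ) (hs : 0 < s) :
    (∫ x : ℝ, (gaussPdf μ₁ s x) ^ α * (gaussPdf μ₂ s x) ^ (1 - α)) =
      Real.exp (α * (α - 1) * (μ₁ - μ₂) ^ 2 / (2 * s ^ 2)) ∧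
    (1 < α →
      (1 / (α - 1)) *
          Real.log (∫ x : ℝ, (gaussPdf μ₁ s x) ^ α * (gaussPdf μ₂ s x) ^ (1 - α)) =
        α * (μ₁ - μ₂) ^ 2 / (2 * s ^ 2)) := by
  have hint : (∫ x : ℝ, (gaussPdf μ₁ s x) ^ α * (gaussPdf μ₂ s x) ^ (1 - α)) =
      Real.exp (α * (α - 1) * (μ₁ - μ₂) ^ 2 / (2 * s ^ 2)) := by
    simp only [gaussPdf_rpow_mul_rpow μ₁ μ₂ α _ hs]
    rw [integral_const_mul, integral_gaussPdf _ hs, mul_one]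
  refine ⟨hint, fun hα => ?_⟩
  have hα' : α - 1 ≠ 0 := (sub_pos.2 hα).ne'
  rw [hint, Real.log_exp]
  field_simp
end

section
/- (Theorem 1 of the paper.) Let X be a type, E = ℝ^d (d-dimensional Euclidean space with Lebesgue measure), f : X → E a per-sample gradient map, C > 0 a clipping bound, B a positive natural number, σ > 0 a noise multiplier, and α > 1. For a multiset S over X of cardinality B define g(S) = (1/B) · ∑_{x ∈ S} clip_C(f(x)), and let s = Cσ/B. Then for any two adjacent multisets S, S' of cardinality B (differing by replacement of a single element), (1/(α−1)) · log ∫_{ℝ^d} (p_{g(S),s}(x))^α · (p_{g(S'),s}(x))^{1−α} dx ≤ 2α/σ². That is, releasing the sanitized per-batch gradient g̃(S) = g(S) + (C/B)·N(0, σ² I_d) satisfies (α, 2α/σ²)-Rényi differential privacy. -/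
open Real MeasureTheory

/-- DP-SGD clipping: `clip C g = g / max 1 (‖g‖/C)` (scalar division). -/
noncomputable def clip {E : Type*} [NormedAddCommGroup E] [NormedSpace ℝ E]
    (C : ℝ) (g : E) : E := (max 1 (‖g‖ / C))⁻¹ • g

/-- Averaged clipped sum over a multiset batch: `g(S) = (1/B) ∑_{x ∈ S} clip_C (f x)`. -/
noncomputable def avgClip {X E : Type*} [NormedAddCommGroup E] [NormedSpace ℝ E]
    (f : X → E) (C : ℝ) (B : ℕ) (S : Multiset X) : E :=
  (B : ℝ)⁻¹ • (S.map (fun x => clip C (f x))).sum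

/-- Isotropic Gaussian density on `ℝ^d` with mean `μ` and scale `s`. -/
noncomputable def gaussPdfD (d : ℕ) (μ : EuclideanSpace ℝ (Fin d)) (s : ℝ)
    (x : EuclideanSpace ℝ (Fin d)) : ℝ :=
  (2 * π * s ^ 2) ^ (-(d : ℝ) / 2) * Real.exp (-‖x - μ‖ ^ 2 / (2 * s ^ 2))

theorem norm_clip_le {E : Type*} [NormedAddCommGroup E] [NormedSpace ℝ E]
    {C : ℝ} (hC : 0 < C) (g : E) : ‖clip C g‖ ≤ C := by
  have hmax : 0 < max 1 (‖g‖ / C) := lt_max_of_lt_left one_pos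
  rw [clip, norm_smul, norm_inv, Real.norm_of_nonneg hmax.le, inv_mul_le_iff₀ hmax]
  calc ‖g‖ = ‖g‖ / C * C := (div_mul_cancel₀ _ hC.ne').symm
    _ ≤ max 1 (‖g‖ / C) * C := by gcongr; exact le_max_right _ _

/-- Replacing one element of a batch moves the averaged clipped sum by at most `2C/B`. -/
theorem norm_avgClip_sub_le {X E : Type*} [DecidableEq X] [NormedAddCommGroup E]
    [NormedSpace ℝ E] (f : X → E) {C : ℝ} (hC : 0 < C) (B : ℕ) {S : Multiset X} {y : X}
    (hy : y ∈ S) (z : X) :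
    ‖avgClip f C B S - avgClip f C B (S.erase y + {z})‖ ≤ 2 * C / B := by
  have hdiff : avgClip f C B S - avgClip f C B (S.erase y + {z}) =
      (B : ℝ)⁻¹ • (clip C (f y) - clip C (f z)) := by
    conv_lhs => rw [← Multiset.cons_erase hy]
    simp only [avgClip, Multiset.erase_cons_head, Multiset.map_cons, Multiset.map_add,
      Multiset.map_singleton, Multiset.sum_cons, Multiset.sum_add, Multiset.sum_singleton,
      ← smul_sub]
    congr 1
    abel
  have hnorm : ‖clip C (f y) - clip C (f z)‖ ≤ 2 * C := by
    linarith [norm_sub_le (clip C (f y)) (clip C (f z)), norm_clip_le hC (f y),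
      norm_clip_le hC (f z)]
  rw [hdiff, norm_smul, norm_inv, RCLike.norm_natCast, div_eq_inv_mul]
  gcongr

theorem integral_gaussPdfD (d : ℕ) (μ : EuclideanSpace ℝ (Fin d)) {s : ℝ} (hs : 0 < s) :
    ∫ x, gaussPdfD d μ s x = 1 := by
  simp only [gaussPdfD]
  rw [integral_const_mul, integral_sub_right_eq_self
    (fun x : EuclideanSpace ℝ (Fin d) => Real.exp (-‖x‖ ^ 2 / (2 * s ^ 2))) μ]
  have h := GaussianFourier.integral_rexp_neg_mul_sq_norm (V := EuclideanSpace ℝ (Fin d))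
    (b := (2 * s ^ 2)⁻¹) (by positivity)
  have hfun : ∀ x : EuclideanSpace ℝ (Fin d),
      -‖x‖ ^ 2 / (2 * s ^ 2) = -(2 * s ^ 2)⁻¹ * ‖x‖ ^ 2 := fun x => by ring
  simp only [hfun, h, finrank_euclideanSpace, Fintype.card_fin]
  rw [div_inv_eq_mul, show π * (2 * s ^ 2) = 2 * π * s ^ 2 by ring,
    ← Real.rpow_add (by positivity), neg_div, neg_add_cancel, Real.rpow_zero]

theorem norm_sq_affine_combination {E : Type*} [NormedAddCommGroup E] [InnerProductSpace ℝ E]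
    (α : ℝ) (u v : E) :
    α * ‖u‖ ^ 2 + (1 - α) * ‖v‖ ^ 2 =
      ‖α • u + (1 - α) • v‖ ^ 2 + α * (1 - α) * ‖u - v‖ ^ 2 := by
  rw [norm_add_sq_real, norm_sub_sq_real, norm_smul, norm_smul, real_inner_smul_left,
    real_inner_smul_right, mul_pow, mul_pow, Real.norm_eq_abs, Real.norm_eq_abs, sq_abs, sq_abs]
  ring

theorem gaussPdfD_rpow_mul_rpow (d : ℕ) (μ ν : EuclideanSpace ℝ (Fin d)) {s : ℝ} (hs : 0 < s)
    (α : ℝ) (x : EuclideanSpace ℝ (Fin d)) :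
    gaussPdfD d μ s x ^ α * gaussPdfD d ν s x ^ (1 - α) =
      Real.exp (α * (α - 1) * ‖μ - ν‖ ^ 2 / (2 * s ^ 2)) *
        gaussPdfD d (α • μ + (1 - α) • ν) s x := by
  have hk : 0 < (2 * π * s ^ 2) ^ (-(d : ℝ) / 2) := by positivity
  have hsq := norm_sq_affine_combination α (x - μ) (x - ν)
  rw [show α • (x - μ) + (1 - α) • (x - ν) = x - (α • μ + (1 - α) • ν) by module,
    sub_sub_sub_cancel_left, norm_sub_rev ν μ] at hsq
  simp only [gaussPdfD]
  generalize (2 * π * s ^ 2) ^ (-(d : ℝ) / 2) = k at hk ⊢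
  rw [Real.mul_rpow hk.le (Real.exp_pos _).le, Real.mul_rpow hk.le (Real.exp_pos _).le,
    mul_mul_mul_comm, ← Real.rpow_add hk, add_sub_cancel, Real.rpow_one, ← Real.exp_mul,
    ← Real.exp_mul, ← Real.exp_add, mul_left_comm, ← Real.exp_add]
  congr 2
  field_simp
  linarith

/-- The Rényi divergence of order `α` between two Gaussians of common scale `s` is
`α‖μ - ν‖² / (2s²)`. -/
theorem renyiDiv_gaussPdfD (d : ℕ) (μ ν : EuclideanSpace ℝ (Fin d)) {s : ℝ} (hs : 0 < s)
    {α : ℝ} (hα : 1 < α) :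
    (1 / (α - 1)) *
        Real.log (∫ x, gaussPdfD d μ s x ^ α * gaussPdfD d ν s x ^ (1 - α)) =
      α * ‖μ - ν‖ ^ 2 / (2 * s ^ 2) := by
  have hα' : α - 1 ≠ 0 := (sub_pos.mpr hα).ne'
  simp only [gaussPdfD_rpow_mul_rpow d μ ν hs α]
  rw [integral_const_mul, integral_gaussPdfD d _ hs, mul_one, Real.log_exp]
  field_simp

/-- Theorem 1 of the paper: releasing the sanitized per-batch gradient
`g̃(S) = g(S) + (C/B)·N(0, σ² I_d)` satisfies `(α, 2α/σ²)`-RDP: for adjacent batches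
`S, S'` of cardinality `B`, the order-`α` Rényi divergence between `N(g(S), s² I_d)`
and `N(g(S'), s² I_d)` with `s = Cσ/B` is at most `2α/σ²`. -/
theorem rapid_rdp {X : Type*} [DecidableEq X] (d : ℕ) (hd : 0 < d)
    (f : X → EuclideanSpace ℝ (Fin d)) {C : ℝ} (hC : 0 < C) {B : ℕ} (hB : 0 < B)
    {σ α : ℝ} (hσ : 0 < σ) (hα : 1 < α)
    (S S' : Multiset X) (hS : Multiset.card S = B)
    (xm xp : X) (hxm : xm ∈ S) (hS' : S' = S.erase xm + {xp}) :
    (1 / (α - 1)) *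
        Real.log (∫ x : EuclideanSpace ℝ (Fin d),
          (gaussPdfD d (avgClip f C B S) (C * σ / B) x) ^ α *
            (gaussPdfD d (avgClip f C B S') (C * σ / B) x) ^ (1 - α)) ≤
      2 * α / σ ^ 2 := by
  subst hS'
  have hB' : (0 : ℝ) < B := Nat.cast_pos.mpr hB
  rw [renyiDiv_gaussPdfD d _ _ (by positivity) hα]
  calc α * ‖avgClip f C B S - avgClip f C B (S.erase xm + {xp})‖ ^ 2 / (2 * (C * σ / B) ^ 2)
      ≤ α * (2 * C / B) ^ 2 / (2 * (C * σ / B) ^ 2) := by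
        gcongr
        exact norm_avgClip_sub_le f hC B hxm xp
    _ = 2 * α / σ ^ 2 := by
        field_simp
end
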